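/- arXiv:2107.09838 — 2 statements merged into one kernel-verified Lean document; each statement's English description precedes it below -/
import Mathlib

section
/- Fix m ≥ 1. For all a, b, c ∈ A(m) we have E_3(a,b,c) ≥ 0. (The FKG inequality E_2(a,b) = E(ab) − E(a)E(b) ≥ 0 for all a,b ∈ A(m) may be assumed as a hypothesis.) -/
/-- `a` belongs to `A(m)`: integer sequences with `m ≥ a_1 ≥ ⋯ ≥ a_m ≥ 0`. -/
def memA (m : ℕ) (a : Fin m → ℤ) : Prop :=
  (∀ j, 0 ≤ a j) ∧ (∀ j, a j ≤ (m : ℤ)) ∧ Antitone a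

/-- Expectation of a sequence: `E(a) = (a_1 + ⋯ + a_m)/m²`. -/
noncomputable def Eseq {m : ℕ} (a : Fin m → ℤ) : ℝ :=
  (∑ j, (a j : ℝ)) / (m : ℝ) ^ 2

/-- Pointwise product of sequences: `(ab)_j = min(a_j, b_j)`. -/
def prodMin {m : ℕ} (a b : Fin m → ℤ) : Fin m → ℤ := fun j => min (a j) (b j)

/-- `a⁺ = a^{+,i}`: agrees with `a` except `(a⁺)_{i+1} = a_i` (here `i` is 0-based,
so positions `i, i+1` are the 1-based positions `i+1, i+2`). -/
def aPlus {m : ℕ} (a : Fin m → ℤ) (i : ℕ) (hi : i + 1 < m) : Fin m → ℤ :=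
  Function.update a ⟨i + 1, hi⟩ (a ⟨i, by omega⟩)

/-- `a⁻ = a^{−,i}`: agrees with `a` except `(a⁻)_i = a_{i+1}`. -/
def aMinus {m : ℕ} (a : Fin m → ℤ) (i : ℕ) (hi : i + 1 < m) : Fin m → ℤ :=
  Function.update a ⟨i, by omega⟩ (a ⟨i + 1, hi⟩)

/-- `a⋆ = a^{⋆,i}`: agrees with `a` except `(a⋆)_{i+1} = a_{i+1} + 1`. -/
def aStar {m : ℕ} (a : Fin m → ℤ) (i : ℕ) (hi : i + 1 < m) : Fin m → ℤ :=
  Function.update a ⟨i + 1, hi⟩ (a ⟨i + 1, hi⟩ + 1)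

/-- `E₃(a,b,c) = 2E(abc) + E(a)E(b)E(c) − E(a)E(bc) − E(b)E(ac) − E(c)E(ab)`. -/
noncomputable def E3seq {m : ℕ} (a b c : Fin m → ℤ) : ℝ :=
  2 * Eseq (prodMin a (prodMin b c)) + Eseq a * Eseq b * Eseq c
    - Eseq a * Eseq (prodMin b c) - Eseq b * Eseq (prodMin a c)
    - Eseq c * Eseq (prodMin a b)

open Equiv (Perm)

/-- The summand of `E₃`, evaluated on the indicator functions `A`, `B`, `C` of three regions at the
three points `(i u, p u)`. -/
def tripleTerm {ι : Type*} (A B C : ι → ι → ℤ) (i p : Fin 3 → ι) : ℤ :=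
  2 * (A (i 0) (p 0) * B (i 0) (p 0) * C (i 0) (p 0)) +
    A (i 0) (p 0) * B (i 1) (p 1) * C (i 2) (p 2) -
    A (i 0) (p 0) * (B (i 1) (p 1) * C (i 1) (p 1)) -
    B (i 0) (p 0) * (A (i 1) (p 1) * C (i 1) (p 1)) -
    C (i 0) (p 0) * (A (i 1) (p 1) * B (i 1) (p 1))

/-- The sum of `A x * B y` over the pairs `x`, `y` which complete `(u, v)` to a permutation matrix. -/
def complementSum {R : Type*} [Semiring R] (A B : Fin 3 → Fin 3 → R) (u v : Fin 3) : R :=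
  A (u + 1) (v + 1) * B (u + 2) (v + 2) + A (u + 1) (v + 2) * B (u + 2) (v + 1) +
    A (u + 2) (v + 1) * B (u + 1) (v + 2) + A (u + 2) (v + 2) * B (u + 1) (v + 1)

/-- The positive part of the coefficient of `C u v` in the symmetrized `tripleTerm A B C`. -/
def posWeight {R : Type*} [Semiring R] (A B : Fin 3 → Fin 3 → R) (u v : Fin 3) : R :=
  8 * (A u v * B u v) + complementSum A B u v

/-- The negative part of the coefficient of `C u v` in the symmetrized `tripleTerm A B C`. -/
def negWeight {R : Type*} [Semiring R] (A B : Fin 3 → Fin 3 → R) (u v : Fin 3) : R :=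
  B u v * complementSum A 1 u v + A u v * complementSum B 1 u v + complementSum (A * B) 1 u v

/-- The sum of the entrywise product of two `3 × 3` arrays, written out so that it evaluates
quickly in the kernel. -/
def entrywiseSum {R : Type*} [Semiring R] (C f : Fin 3 → Fin 3 → R) : R :=
  C 0 0 * f 0 0 + C 0 1 * f 0 1 + C 0 2 * f 0 2 +
    C 1 0 * f 1 0 + C 1 1 * f 1 1 + C 1 2 * f 1 2 +
    C 2 0 * f 2 0 + C 2 1 * f 2 1 + C 2 2 * f 2 2

theorem sum_perm_fin_three {M : Type*} [AddCommMonoid M] (f : (Fin 3 → Fin 3) → M) :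
    ∑ σ : Perm (Fin 3), f σ =
      f ![0, 1, 2] + f ![1, 0, 2] + f ![2, 1, 0] + f ![0, 2, 1] + f ![1, 2, 0] + f ![2, 0, 1] := by
  have huniv : (Finset.univ : Finset (Perm (Fin 3))) =
      {1, Equiv.swap 0 1, Equiv.swap 0 2, Equiv.swap 1 2, Equiv.swap 0 1 * Equiv.swap 1 2,
        Equiv.swap 1 2 * Equiv.swap 0 1} := by decide
  rw [huniv, Finset.sum_insert (by decide), Finset.sum_insert (by decide),
    Finset.sum_insert (by decide), Finset.sum_insert (by decide), Finset.sum_insert (by decide),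
    Finset.sum_singleton]
  simp only [← add_assoc]
  congr <;> decide

set_option maxHeartbeats 1000000 in
theorem sum_perm_tripleTerm (A B C : Fin 3 → Fin 3 → ℤ) :
    ∑ σ : Perm (Fin 3), ∑ τ : Perm (Fin 3), tripleTerm A B C σ τ =
      entrywiseSum C (posWeight A B) - entrywiseSum C (negWeight A B) := by
  rw [sum_perm_fin_three (fun s => ∑ τ : Perm (Fin 3), tripleTerm A B C s τ)]
  simp_rw [fun s => sum_perm_fin_three (tripleTerm A B C s)]
  simp [tripleTerm, posWeight, negWeight, complementSum, entrywiseSum]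
  ring

/-- The indicator array of the staircase with rows of lengths `d.1`, `d.2.1`, `d.2.2`. -/
def stair (d : ℕ × ℕ × ℕ) (u v : Fin 3) : ℕ :=
  if v.val < ![d.1, d.2.1, d.2.2] u then 1 else 0

/-- The weakly decreasing row lengths of staircases in the `3 × 3` square. -/
def stairShapes : List (ℕ × ℕ × ℕ) :=
  (List.range 4).flatMap fun x => (List.range (x + 1)).flatMap fun y =>
    (List.range (y + 1)).map fun z => (x, y, z)

theorem mem_stairShapes {x y z : ℕ} :
    (x, y, z) ∈ stairShapes ↔ x ≤ 3 ∧ y ≤ x ∧ z ≤ y := by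
  simp [stairShapes]
  omega

theorem entrywiseSum_negWeight_le_posWeight :
    ∀ a ∈ stairShapes, ∀ b ∈ stairShapes, ∀ c ∈ stairShapes,
      entrywiseSum (stair c) (negWeight (stair a) (stair b)) ≤
        entrywiseSum (stair c) (posWeight (stair a) (stair b)) := by
  decide +kernel

theorem sum_perm_tripleTerm_stair_nonneg {a b c : ℕ × ℕ × ℕ} (ha : a ∈ stairShapes)
    (hb : b ∈ stairShapes) (hc : c ∈ stairShapes) :
    0 ≤ ∑ σ : Perm (Fin 3), ∑ τ : Perm (Fin 3),
      tripleTerm (fun u v => (stair a u v : ℤ)) (fun u v => (stair b u v : ℤ))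
        (fun u v => (stair c u v : ℤ)) σ τ := by
  rw [sum_perm_tripleTerm, sub_nonneg]
  have h := Int.ofNat_le.2 (entrywiseSum_negWeight_le_posWeight a ha b hb c hc)
  simp only [entrywiseSum, posWeight, negWeight, complementSum, Pi.mul_apply, Pi.one_apply] at h ⊢
  exact_mod_cast h

theorem Monotone.exists_lt_iff_val_lt {x : Fin 3 → ℤ} (hx : Monotone x) (t : ℤ) :
    ∃ d ≤ 3, ∀ v, x v < t ↔ v.val < d := by
  have h01 : x 0 ≤ x 1 := hx (by decide)
  have h12 : x 1 ≤ x 2 := hx (by decide)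
  simp only [Fin.forall_fin_succ, Fin.forall_fin_zero]
  by_cases h0 : x 0 < t
  · by_cases h1 : x 1 < t
    · by_cases h2 : x 2 < t
      · exact ⟨3, by simp [h0, h1, h2]⟩
      · exact ⟨2, by simp [h0, h1]; omega⟩
    · exact ⟨1, by simp [h0]; omega⟩
  · exact ⟨0, by simp; omega⟩

/-- The region below an antitone threshold, sampled on a `3 × 3` grid, is a staircase. -/
theorem exists_stair_eq {x t : Fin 3 → ℤ} (hx : Monotone x) (ht : Antitone t) :
    ∃ s ∈ stairShapes, ∀ u v, (if x v < t u then 1 else 0 : ℤ) = stair s u v := by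
  choose d hd3 hd using fun u => hx.exists_lt_iff_val_lt (t u)
  have hanti : Antitone d := by
    intro u w huw
    by_contra! hlt
    have hw := hd3 w
    have h := (hd w ⟨d u, by omega⟩).2 hlt
    exact lt_irrefl _ ((hd u ⟨d u, by omega⟩).1 (h.trans_le (ht huw)))
  refine ⟨(d 0, d 1, d 2), mem_stairShapes.2 ⟨hd3 0, hanti (by decide), hanti (by decide)⟩, ?_⟩
  intro u v
  have hdu : ![d 0, d 1, d 2] u = d u := by fin_cases u <;> rfl
  simp [stair, hd, hdu]

/-- A sum over pairs of triples is nonnegative if its symmetrization is nonnegative at pairs of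
monotone triples. -/
theorem sum_nonneg_of_symmetrized_nonneg {ι : Type*} [Fintype ι] [LinearOrder ι] {n : ℕ}
    (f : (Fin n → ι) → (Fin n → ι) → ℤ)
    (hf : ∀ i p : Fin n → ι, Monotone i → Monotone p →
      0 ≤ ∑ σ : Perm (Fin n), ∑ τ : Perm (Fin n), f (i ∘ σ) (p ∘ τ)) :
    0 ≤ ∑ i, ∑ p, f i p := by
  have hcomp (g : (Fin n → ι) → ℤ) (σ : Perm (Fin n)) : ∑ i, g (i ∘ σ) = ∑ i, g i :=
    Equiv.sum_comp (Equiv.arrowCongr σ.symm (Equiv.refl ι)) g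
  have hsymm (i p : Fin n → ι) :
      0 ≤ ∑ σ : Perm (Fin n), ∑ τ : Perm (Fin n), f (i ∘ σ) (p ∘ τ) := by
    have h := hf _ _ (Tuple.monotone_sort i) (Tuple.monotone_sort p)
    simp only [Function.comp_assoc, ← Equiv.Perm.coe_mul] at h
    have hmul (g : Perm (Fin n) → ℤ) (ρ : Perm (Fin n)) : ∑ σ, g (ρ * σ) = ∑ σ, g σ :=
      Equiv.sum_comp (Equiv.mulLeft ρ) g
    rw [hmul (fun σ => ∑ τ : Perm (Fin n), f (i ∘ σ) (p ∘ (Tuple.sort p * τ : Perm (Fin n))))] at h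
    simp_rw [fun σ : Perm (Fin n) => hmul (fun τ => f (i ∘ σ) (p ∘ τ))] at h
    exact h
  have htotal : ∑ i, ∑ p, ∑ σ : Perm (Fin n), ∑ τ : Perm (Fin n), f (i ∘ σ) (p ∘ τ) =
      (n.factorial * n.factorial : ℤ) * ∑ i, ∑ p, f i p := by
    calc ∑ i, ∑ p, ∑ σ : Perm (Fin n), ∑ τ : Perm (Fin n), f (i ∘ σ) (p ∘ τ)
        = ∑ i, ∑ σ : Perm (Fin n), ∑ τ : Perm (Fin n), ∑ p, f (i ∘ σ) (p ∘ τ) := by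
          refine Finset.sum_congr rfl fun i _ => ?_
          rw [Finset.sum_comm]
          exact Finset.sum_congr rfl fun σ _ => Finset.sum_comm
      _ = ∑ σ : Perm (Fin n), ∑ i, (n.factorial : ℤ) * ∑ p, f (i ∘ σ) p := by
          simp_rw [fun (i : Fin n → ι) (σ : Perm (Fin n)) => hcomp (f (i ∘ σ))]
          rw [Finset.sum_comm]
          simp [Fintype.card_perm]
      _ = _ := by
          simp_rw [hcomp (fun i => (n.factorial : ℤ) * ∑ p, f i p), ← Finset.mul_sum]
          simp [Fintype.card_perm, mul_assoc]
  have hpos : (0 : ℤ) < n.factorial * n.factorial := by positivity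
  refine nonneg_of_mul_nonneg_right (htotal ▸ ?_) hpos
  exact Finset.sum_nonneg fun i _ => Finset.sum_nonneg fun p _ => hsymm i p

theorem sum_triple_mul {ι R : Type*} [Fintype ι] [CommSemiring R] (f g h : ι → ι → R) :
    ∑ i : Fin 3 → ι, ∑ p : Fin 3 → ι, f (i 0) (p 0) * g (i 1) (p 1) * h (i 2) (p 2) =
      (∑ x, ∑ y, f x y) * (∑ x, ∑ y, g x y) * ∑ x, ∑ y, h x y := by
  classical
  have hprod (F : Fin 3 → ι → R) :
      ∑ i : Fin 3 → ι, F 0 (i 0) * F 1 (i 1) * F 2 (i 2) =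
        (∑ x, F 0 x) * (∑ x, F 1 x) * ∑ x, F 2 x := by
    simpa [Fin.prod_univ_three] using
      (Finset.prod_univ_sum (fun _ : Fin 3 => (Finset.univ : Finset ι)) F).symm
  have hinner (i : Fin 3 → ι) := hprod ![f (i 0), g (i 1), h (i 2)]
  have houter := hprod ![fun x => ∑ y, f x y, fun x => ∑ y, g x y, fun x => ∑ y, h x y]
  simp at hinner houter
  simp_rw [hinner, houter]

theorem sum_tripleTerm {ι : Type*} [Fintype ι] (A B C : ι → ι → ℤ) :
    ∑ i, ∑ p, tripleTerm A B C i p =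
      2 * (∑ x, ∑ y, A x y * B x y * C x y) * (Fintype.card ι : ℤ) ^ 4 +
        (∑ x, ∑ y, A x y) * (∑ x, ∑ y, B x y) * (∑ x, ∑ y, C x y) -
        (∑ x, ∑ y, A x y) * (∑ x, ∑ y, B x y * C x y) * (Fintype.card ι : ℤ) ^ 2 -
        (∑ x, ∑ y, B x y) * (∑ x, ∑ y, A x y * C x y) * (Fintype.card ι : ℤ) ^ 2 -
        (∑ x, ∑ y, C x y) * (∑ x, ∑ y, A x y * B x y) * (Fintype.card ι : ℤ) ^ 2 := by
  have h1 := sum_triple_mul (fun x y => A x y * B x y * C x y) 1 1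
  have h2 := sum_triple_mul A (fun x y => B x y * C x y) 1
  have h3 := sum_triple_mul B (fun x y => A x y * C x y) 1
  have h4 := sum_triple_mul C (fun x y => A x y * B x y) 1
  simp only [Pi.one_apply, mul_one, Finset.sum_const, Finset.card_univ, nsmul_eq_mul] at h1 h2 h3 h4
  simp only [tripleTerm, Finset.sum_add_distrib, Finset.sum_sub_distrib, ← Finset.mul_sum,
    sum_triple_mul, h1, h2, h3, h4]
  ring

/-- The indicator function of the region below the graph of `a`. -/
def belowInd {m : ℕ} (a : Fin m → ℤ) (i p : Fin m) : ℤ :=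
  if ((p : ℕ) : ℤ) < a i then 1 else 0

theorem belowInd_prodMin {m : ℕ} (a b : Fin m → ℤ) (i p : Fin m) :
    belowInd (prodMin a b) i p = belowInd a i p * belowInd b i p := by
  simp only [belowInd, prodMin, lt_min_iff, ite_zero_mul_ite_zero, mul_one]

theorem sum_belowInd {m : ℕ} {a : Fin m → ℤ} (i : Fin m) (h0 : 0 ≤ a i) (hm : a i ≤ m) :
    ∑ p, belowInd a i p = a i := by
  lift a i to ℕ using h0 with n hn
  have hnm : n ≤ m := by exact_mod_cast hm
  simp only [belowInd, ← hn, Nat.cast_lt]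
  rw [Fin.sum_univ_eq_sum_range (fun p => if p < n then (1 : ℤ) else 0) m, Finset.sum_boole]
  have : (Finset.range m).filter (· < n) = Finset.range n := by
    ext p
    simp
    omega
  simp [this]

theorem Eseq_eq_sum_belowInd {m : ℕ} {a : Fin m → ℤ} (ha : memA m a) :
    Eseq a = ((∑ i, ∑ p, belowInd a i p : ℤ) : ℝ) / (m : ℝ) ^ 2 := by
  simp_rw [fun i => sum_belowInd i (ha.1 i) (ha.2.1 i)]
  simp [Eseq]

theorem memA_prodMin {m : ℕ} {a b : Fin m → ℤ} (ha : memA m a) (hb : memA m b) :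
    memA m (prodMin a b) :=
  ⟨fun j => le_min (ha.1 j) (hb.1 j), fun j => (min_le_left _ _).trans (ha.2.1 j),
    fun _ _ h => min_le_min (ha.2.2 h) (hb.2.2 h)⟩

theorem sum_tripleTerm_belowInd_nonneg {m : ℕ} {a b c : Fin m → ℤ} (ha : Antitone a)
    (hb : Antitone b) (hc : Antitone c) :
    0 ≤ ∑ i, ∑ p, tripleTerm (belowInd a) (belowInd b) (belowInd c) i p := by
  refine sum_nonneg_of_symmetrized_nonneg _ fun i p hi hp => ?_
  have hx : Monotone fun v => ((p v : ℕ) : ℤ) := fun _ _ h => Int.ofNat_le.2 (hp h)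
  obtain ⟨s, hs, hsa⟩ := exists_stair_eq hx (ha.comp_monotone hi)
  obtain ⟨t, ht, htb⟩ := exists_stair_eq hx (hb.comp_monotone hi)
  obtain ⟨r, hr, hrc⟩ := exists_stair_eq hx (hc.comp_monotone hi)
  have h := sum_perm_tripleTerm_stair_nonneg hs ht hr
  simp only [← hsa, ← htb, ← hrc] at h
  exact h

/-- For all `a, b, c ∈ A(m)` we have `E₃(a,b,c) ≥ 0`.  The FKG inequality
`E(xy) − E(x)E(y) ≥ 0` for sequences in `A(m)` is assumed as a hypothesis. -/
theorem stmt_5 (m : ℕ) (hm : 1 ≤ m)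
    (hFKG : ∀ x y : Fin m → ℤ, memA m x → memA m y →
      Eseq x * Eseq y ≤ Eseq (prodMin x y))
    (a b c : Fin m → ℤ) (ha : memA m a) (hb : memA m b) (hc : memA m c) :
    0 ≤ E3seq a b c := by
  have hm0 : (m : ℝ) ≠ 0 := by positivity
  have hsum := sum_tripleTerm_belowInd_nonneg ha.2.2 hb.2.2 hc.2.2
  rw [sum_tripleTerm, Fintype.card_fin] at hsum
  have hsumR : (0 : ℝ) ≤ _ := Int.cast_nonneg hsum
  have hdiv := div_nonneg hsumR (by positivity : (0 : ℝ) ≤ (m : ℝ) ^ 6)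
  have hab := memA_prodMin ha hb
  have hac := memA_prodMin ha hc
  have hbc := memA_prodMin hb hc
  rw [E3seq, Eseq_eq_sum_belowInd ha, Eseq_eq_sum_belowInd hb, Eseq_eq_sum_belowInd hc,
    Eseq_eq_sum_belowInd hab, Eseq_eq_sum_belowInd hac, Eseq_eq_sum_belowInd hbc,
    Eseq_eq_sum_belowInd (memA_prodMin ha hbc)]
  simp only [belowInd_prodMin, ← mul_assoc]
  refine hdiv.trans_eq ?_
  rw [Int.cast_sub, Int.cast_sub, Int.cast_sub, Int.cast_add]
  simp only [Int.cast_mul, Int.cast_pow, Int.cast_natCast, Int.cast_ofNat]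
  field_simp
end

section
/- Let k, n ≥ 1 and let f^1, …, f^n be nonnegative, bounded, measurable, monotone decreasing functions on [0,1]^k such that for every s > 0 and every i, the upper level set {x ∈ [0,1]^k : f^i(x) > s} is a k-rectangle [0,r_1] × ⋯ × [0,r_k] (possibly empty, with the rectangles for different s not necessarily homothetic). Then, with respect to Lebesgue measure on [0,1]^k, E_n(f^1, …, f^n) ≥ 0. -/
open MeasureTheory

/-- The orbits (cycles, counting fixed points as 1-cycles) of a permutation `σ`
of a finite index type, as a finset of finsets. -/
def permOrbits {ι : Type*} [Fintype ι] [DecidableEq ι] (σ : Equiv.Perm ι) : Finset (Finset ι) :=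
  Finset.univ.image fun x => Finset.univ.filter fun y => σ.SameCycle x y

/-- `E_σ(f¹,…,fⁿ) = ∏_{O orbit of σ} E(∏_{i ∈ O} fⁱ)`, the expectation being the
integral with respect to `μ`. -/
noncomputable def permE {Ω : Type*} [MeasurableSpace Ω] (μ : Measure Ω)
    {ι : Type*} [Fintype ι] [DecidableEq ι] (f : ι → Ω → ℝ) (σ : Equiv.Perm ι) : ℝ :=
  ∏ O ∈ permOrbits σ, ∫ ω, (∏ i ∈ O, f i ω) ∂μ

/-- Sahi's functional `E_n(f¹,…,fⁿ) = ∑_{σ ∈ S_n} (−1)^{C_σ − 1} E_σ(f¹,…,fⁿ)`,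
where `C_σ` is the number of orbits of `σ`. -/
noncomputable def En {Ω : Type*} [MeasurableSpace Ω] (μ : Measure Ω)
    {ι : Type*} [Fintype ι] [DecidableEq ι] (f : ι → Ω → ℝ) : ℝ :=
  ∑ σ : Equiv.Perm ι, (-1 : ℝ) ^ ((permOrbits σ).card - 1) * permE μ f σ

section Combinatorics

open Equiv Finset

variable {ι : Type*} [Fintype ι] [DecidableEq ι]

/-- The orbit of `x` under `σ`. -/
def permOrbit (σ : Perm ι) (x : ι) : Finset ι :=
  Finset.univ.filter fun y => σ.SameCycle x y

/-- The permutations fixing every point outside `S`. -/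
def permsOn (S : Finset ι) : Finset (Perm ι) :=
  Finset.univ.filter fun σ => ∀ x, x ∉ S → σ x = x

/-- The sum over the permutations of `S` of the product of the weights of their orbits. -/
def orbitSum {R : Type*} [CommRing R] (w : Finset ι → R) (S : Finset ι) : R :=
  ∑ σ ∈ permsOn S, ∏ O ∈ S.image (permOrbit σ), w O

lemma mem_permOrbit {σ : Perm ι} {x y : ι} : y ∈ permOrbit σ x ↔ σ.SameCycle x y := by
  simp [permOrbit]

lemma mem_permsOn {S : Finset ι} {σ : Perm ι} : σ ∈ permsOn S ↔ ∀ x, x ∉ S → σ x = x := by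
  simp [permsOn]

lemma self_mem_permOrbit (σ : Perm ι) (x : ι) : x ∈ permOrbit σ x :=
  mem_permOrbit.2 (Perm.SameCycle.refl σ x)

lemma permOrbit_cycleOf (σ : Perm ι) (x : ι) : permOrbit (σ.cycleOf x) x = permOrbit σ x := by
  ext y
  simp only [mem_permOrbit, Perm.SameCycle, Perm.cycleOf_zpow_apply_self]

lemma permOrbit_congr {σ τ : Perm ι} {x : ι} (h : σ.cycleOf x = τ.cycleOf x) :
    permOrbit σ x = permOrbit τ x := by
  rw [← permOrbit_cycleOf, h, permOrbit_cycleOf]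

lemma permOrbit_eq_of_mem {σ : Perm ι} {x y : ι} (h : y ∈ permOrbit σ x) :
    permOrbit σ y = permOrbit σ x := by
  ext z
  rw [mem_permOrbit] at *
  rw [mem_permOrbit]
  exact ⟨fun hz => h.trans hz, fun hz => h.symm.trans hz⟩

lemma permOrbit_subset {S : Finset ι} {σ : Perm ι} (hσ : σ ∈ permsOn S) {x : ι} (hx : x ∈ S) :
    permOrbit σ x ⊆ S := by
  intro y hy
  by_contra hyS
  have hfix : Function.IsFixedPt σ y := mem_permsOn.1 hσ y hyS
  have := (mem_permOrbit.1 hy).symm.eq_of_left hfix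
  exact hyS (this ▸ hx)

lemma cycleOf_cycleOf (σ : Perm ι) (a : ι) : (σ.cycleOf a).cycleOf a = σ.cycleOf a := by
  by_cases h : σ a = a
  · rw [(Perm.cycleOf_eq_one_iff σ).2 h, Perm.cycleOf_one]
  · exact (Perm.isCycle_cycleOf σ h).cycleOf_eq (by simpa using h)

lemma cycleOf_mem_permsOn {S : Finset ι} {σ : Perm ι} (hσ : σ ∈ permsOn S) (a : ι) :
    σ.cycleOf a ∈ permsOn S := by
  rw [mem_permsOn] at *
  intro x hx
  rw [Perm.cycleOf_apply]
  split_ifs <;> simp [hσ x hx]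

lemma cycleOf_inv_mul_mem_permsOn {S : Finset ι} {σ : Perm ι} (hσ : σ ∈ permsOn S) (a : ι) :
    (σ.cycleOf a)⁻¹ * σ ∈ permsOn (S \ permOrbit σ a) := by
  rw [mem_permsOn]
  intro x hx
  rw [Perm.mul_apply, Perm.inv_eq_iff_eq]
  by_cases h : σ.SameCycle a x
  · rw [h.cycleOf_apply]
  · have hxS : x ∉ S := by
      simpa [mem_permOrbit, h] using hx
    rw [mem_permsOn.1 hσ x hxS, Perm.cycleOf_apply_of_not_sameCycle h]

lemma apply_eq_self_of_cycleOf_eq {τ : Perm ι} {a x : ι} (hτ : τ.cycleOf a = τ)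
    (hx : x ∉ permOrbit τ a) : τ x = x := by
  rw [← hτ]
  exact Perm.cycleOf_apply_of_not_sameCycle (fun h => hx (mem_permOrbit.2 h))

lemma disjoint_of_mem_permsOn_sdiff {S : Finset ι} {τ ρ : Perm ι} {a : ι}
    (hτ : τ.cycleOf a = τ) (hρ : ρ ∈ permsOn (S \ permOrbit τ a)) : τ.Disjoint ρ := by
  intro x
  by_cases hx : x ∈ permOrbit τ a
  · exact Or.inr (mem_permsOn.1 hρ x (by simp [hx]))
  · exact Or.inl (apply_eq_self_of_cycleOf_eq hτ hx)

lemma cycleOf_mul_eq {S : Finset ι} {τ ρ : Perm ι} {a : ι}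
    (hτ : τ.cycleOf a = τ) (hρ : ρ ∈ permsOn (S \ permOrbit τ a)) : (τ * ρ).cycleOf a = τ := by
  rw [Perm.cycleOf_mul_of_apply_right_eq_self (disjoint_of_mem_permsOn_sdiff hτ hρ).commute _
    (mem_permsOn.1 hρ a (by simp [self_mem_permOrbit])), hτ]

lemma image_permOrbit_mul {S : Finset ι} {τ ρ : Perm ι} {a : ι} (ha : a ∈ S)
    (hτS : τ ∈ permsOn S) (hτ : τ.cycleOf a = τ) (hρ : ρ ∈ permsOn (S \ permOrbit τ a)) :
    S.image (permOrbit (τ * ρ)) =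
      insert (permOrbit τ a) ((S \ permOrbit τ a).image (permOrbit ρ)) := by
  have hcomm := (disjoint_of_mem_permsOn_sdiff hτ hρ).commute
  have hUa : permOrbit (τ * ρ) a = permOrbit τ a :=
    permOrbit_congr ((cycleOf_mul_eq hτ hρ).trans hτ.symm)
  have hU : ∀ x ∈ permOrbit τ a, permOrbit (τ * ρ) x = permOrbit τ a := fun x hx => by
    rw [← hUa] at hx ⊢
    exact permOrbit_eq_of_mem hx
  have hout : ∀ x, x ∉ permOrbit τ a → permOrbit (τ * ρ) x = permOrbit ρ x := fun x hx => by
    refine permOrbit_congr ?_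
    rw [hcomm.eq, Perm.cycleOf_mul_of_apply_right_eq_self hcomm.symm _
      (apply_eq_self_of_cycleOf_eq hτ hx)]
  have hsub := permOrbit_subset hτS ha
  ext O
  simp only [mem_image, mem_insert, mem_sdiff]
  constructor
  · rintro ⟨x, hx, rfl⟩
    by_cases h : x ∈ permOrbit τ a
    · exact Or.inl (hU x h)
    · exact Or.inr ⟨x, ⟨hx, h⟩, (hout x h).symm⟩
  · rintro (rfl | ⟨x, ⟨hx, h⟩, rfl⟩)
    · exact ⟨a, ha, hUa⟩
    · exact ⟨x, hx, hout x h⟩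

lemma permOrbit_notMem_image {S : Finset ι} {τ ρ : Perm ι} {a : ι}
    (hρ : ρ ∈ permsOn (S \ permOrbit τ a)) :
    permOrbit τ a ∉ (S \ permOrbit τ a).image (permOrbit ρ) := by
  simp only [mem_image, not_exists, not_and]
  intro x hx h
  have := permOrbit_subset hρ hx (h ▸ self_mem_permOrbit τ a)
  simp [self_mem_permOrbit] at this

/-- The permutations of `S` whose only possibly nontrivial cycle goes through `a`. -/
def cyclesOn (S : Finset ι) (a : ι) : Finset (Perm ι) :=
  (permsOn S).filter fun τ => τ.cycleOf a = τ

lemma mem_cyclesOn {S : Finset ι} {a : ι} {τ : Perm ι} :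
    τ ∈ cyclesOn S a ↔ τ ∈ permsOn S ∧ τ.cycleOf a = τ := by
  simp [cyclesOn]

/-- Grouping the permutations of `S` by the cycle through `a`. -/
lemma orbitSum_eq_sum_cyclesOn {R : Type*} [CommRing R] (w : Finset ι → R) {S : Finset ι} {a : ι}
    (ha : a ∈ S) :
    orbitSum w S = ∑ τ ∈ cyclesOn S a, w (permOrbit τ a) * orbitSum w (S \ permOrbit τ a) := by
  simp only [orbitSum, mul_sum]
  rw [sum_sigma']
  refine sum_bij' (fun σ _ => ⟨σ.cycleOf a, (σ.cycleOf a)⁻¹ * σ⟩) (fun p _ => p.1 * p.2)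
    ?_ ?_ ?_ ?_ ?_
  · intro σ hσ
    simp only [mem_sigma, mem_cyclesOn, permOrbit_cycleOf]
    exact ⟨⟨cycleOf_mem_permsOn hσ a, cycleOf_cycleOf σ a⟩, cycleOf_inv_mul_mem_permsOn hσ a⟩
  · rintro ⟨τ, ρ⟩ h
    simp only [mem_sigma, mem_cyclesOn] at h
    rw [mem_permsOn]
    intro x hx
    rw [Perm.mul_apply, mem_permsOn.1 h.2 x (by simp [hx]), mem_permsOn.1 h.1.1 x hx]
  · intro σ _
    simp
  · rintro ⟨τ, ρ⟩ h
    simp only [mem_sigma, mem_cyclesOn] at h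
    simp [cycleOf_mul_eq h.1.2 h.2]
  · intro σ hσ
    have hρ := cycleOf_inv_mul_mem_permsOn hσ a
    rw [← permOrbit_cycleOf] at hρ
    rw [← prod_insert (permOrbit_notMem_image hρ),
      ← image_permOrbit_mul ha (cycleOf_mem_permsOn hσ a) (cycleOf_cycleOf σ a) hρ, mul_inv_cancel_left]

lemma orbitSum_empty {R : Type*} [CommRing R] (w : Finset ι → R) : orbitSum w ∅ = 1 := by
  have : permsOn (∅ : Finset ι) = {1} := by
    ext σ
    simp [mem_permsOn, Perm.ext_iff]
  simp [orbitSum, this]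

lemma orbitSum_congr {R : Type*} [CommRing R] {w w' : Finset ι → R} {S : Finset ι}
    (h : ∀ O ⊆ S, O.Nonempty → w O = w' O) : orbitSum w S = orbitSum w' S := by
  refine sum_congr rfl fun σ hσ => prod_congr rfl fun O hO => ?_
  obtain ⟨x, hx, rfl⟩ := mem_image.1 hO
  exact h _ (permOrbit_subset hσ hx) ⟨x, self_mem_permOrbit σ x⟩

lemma sign_eq_of_cycleOf_eq {τ : Perm ι} {a : ι} (hτ : τ.cycleOf a = τ) :
    Perm.sign τ = -(-1) ^ #(permOrbit τ a) := by
  by_cases h : τ a = a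
  · have h1 : τ = 1 := hτ ▸ (Perm.cycleOf_eq_one_iff τ).2 h
    have h2 : permOrbit (1 : Perm ι) a = {a} := by
      ext y
      simp [mem_permOrbit, eq_comm]
    simp [h1, h2]
  · have hsupp : τ.support = permOrbit τ a := by
      ext y
      rw [mem_permOrbit, ← Perm.mem_support_cycleOf_iff' h, hτ]
    rw [← hsupp]
    exact (hτ ▸ Perm.isCycle_cycleOf τ h).sign

/-- The sign of a permutation in terms of its number of orbits. -/
lemma prod_neg_one_image_permOrbit (S : Finset ι) :
    ∀ σ ∈ permsOn S, (∏ _O ∈ S.image (permOrbit σ), (-1 : ℤˣ)) = (-1) ^ #S * Perm.sign σ := by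
  induction S using Finset.strongInduction with
  | H S ih =>
    intro σ hσ
    obtain rfl | ⟨a, ha⟩ := S.eq_empty_or_nonempty
    · have : σ = 1 := Perm.ext fun x => mem_permsOn.1 hσ x (notMem_empty x)
      simp [this]
    · have hτS := cycleOf_mem_permsOn hσ a
      have hτ := cycleOf_cycleOf σ a
      have hρ := cycleOf_inv_mul_mem_permsOn hσ a
      rw [← permOrbit_cycleOf] at hρ
      have hσ' : σ = σ.cycleOf a * ((σ.cycleOf a)⁻¹ * σ) := by simp
      set τ := σ.cycleOf a
      set ρ := τ⁻¹ * σ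
      have hsub := permOrbit_subset hτS ha
      rw [hσ', image_permOrbit_mul ha hτS hτ hρ, prod_insert (permOrbit_notMem_image hρ),
        ih _ (sdiff_ssubset hsub ⟨a, self_mem_permOrbit τ a⟩) ρ hρ, Perm.sign_mul τ ρ,
        sign_eq_of_cycleOf_eq hτ, ← card_sdiff_add_card_eq_card hsub, pow_add]
      have h2 : ((-1 : ℤˣ) ^ #(permOrbit τ a)) * (-1) ^ #(permOrbit τ a) = 1 := by
        rw [← mul_pow]
        simp
      calc _ = -((-1 : ℤˣ) ^ #(S \ permOrbit τ a) * Perm.sign ρ) := by simp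
        _ = -((-1 : ℤˣ) ^ #(S \ permOrbit τ a) * Perm.sign ρ) *
            (((-1 : ℤˣ) ^ #(permOrbit τ a)) * (-1) ^ #(permOrbit τ a)) := by rw [h2, mul_one]
        _ = _ := by
          simp only [neg_mul, mul_neg, neg_inj]
          ac_rfl

lemma sum_sign_permsOn {S : Finset ι} {a b : ι} (ha : a ∈ S) (hb : b ∈ S) (hab : a ≠ b) :
    ∑ σ ∈ permsOn S, ((Perm.sign σ : ℤˣ) : ℝ) = 0 := by
  refine sum_involution (fun σ _ => swap a b * σ) ?_ ?_ ?_ ?_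
  · intro σ _
    simp [Perm.sign_swap hab]
  · intro σ _ _ h
    exact hab (swap_eq_one_iff.1 (mul_eq_right.1 h))
  · intro σ hσ
    rw [mem_permsOn] at *
    intro x hx
    rw [Perm.mul_apply, hσ x hx]
    exact swap_apply_of_ne_of_ne (fun h => hx (h ▸ ha)) (fun h => hx (h ▸ hb))
  · intro σ _
    simp [← mul_assoc]

lemma orbitSum_neg_one_nonpos {S : Finset ι} (hS : S.Nonempty) :
    orbitSum (fun _ => (-1 : ℝ)) S ≤ 0 := by
  have key : ∀ σ ∈ permsOn S, (∏ _O ∈ S.image (permOrbit σ), (-1 : ℝ)) =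
      (-1) ^ #S * ((Perm.sign σ : ℤˣ) : ℝ) := fun σ hσ => by
    have := congrArg (fun u : ℤˣ => ((u : ℤ) : ℝ)) (prod_neg_one_image_permOrbit S σ hσ)
    simpa using this
  rw [orbitSum, sum_congr rfl key, ← mul_sum]
  obtain ⟨a, rfl⟩ | hS' := hS.exists_eq_singleton_or_nontrivial
  · have : permsOn ({a} : Finset ι) = {1} := by
      ext σ
      simp only [mem_permsOn, mem_singleton]
      refine ⟨fun h => Perm.ext fun x => ?_, fun h => by simp [h]⟩
      by_cases hx : x = a
      · subst hx
        by_contra hne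
        exact hne (σ.injective (h _ hne))
      · exact h x hx
    simp [this]
  · obtain ⟨a, ha, b, hb, hab⟩ := hS'
    rw [sum_sign_permsOn ha hb hab, mul_zero]

/-- Scaling the weights of the sets containing a given point scales the orbit sum. -/
lemma orbitSum_scale {w w' : Finset ι → ℝ} {S : Finset ι} {b : ι} (hb : b ∈ S) (c : ℝ)
    (hin : ∀ O, b ∈ O → w' O = c * w O) (hout : ∀ O, b ∉ O → w' O = w O) :
    orbitSum w' S = c * orbitSum w S := by
  rw [orbitSum_eq_sum_cyclesOn w' hb, orbitSum_eq_sum_cyclesOn w hb, mul_sum]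
  refine sum_congr rfl fun τ _ => ?_
  rw [hin _ (self_mem_permOrbit τ b), mul_assoc]
  congr 2
  exact orbitSum_congr fun O hO _ => hout O fun h => by
    simpa [self_mem_permOrbit] using hO h

/-- Raising the masses of the sets containing `a`, but not the mass of `S` itself, raises the
orbit sum of `S` as soon as the orbit sums of smaller nonempty sets are nonpositive. -/
lemma orbitSum_neg_le_orbitSum_neg {m m' : Finset ι → ℝ} {S : Finset ι} {a : ι} (ha : a ∈ S)
    (hle : ∀ O, m O ≤ m' O) (hS : m S = m' S) (hout : ∀ O, a ∉ O → m O = m' O)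
    (hind : ∀ T ⊂ S, T.Nonempty → orbitSum (fun O => -m O) T ≤ 0) :
    orbitSum (fun O => -m O) S ≤ orbitSum (fun O => -m' O) S := by
  rw [orbitSum_eq_sum_cyclesOn _ ha, orbitSum_eq_sum_cyclesOn _ ha]
  refine sum_le_sum fun τ hτ => ?_
  have hrest : orbitSum (fun O => -m' O) (S \ permOrbit τ a) =
      orbitSum (fun O => -m O) (S \ permOrbit τ a) :=
    orbitSum_congr fun O hO _ => by
      rw [hout O fun h => by simpa [self_mem_permOrbit] using hO h]
  rw [hrest]
  have hsub := permOrbit_subset (mem_cyclesOn.1 hτ).1 ha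
  obtain hemp | hne := (S \ permOrbit τ a).eq_empty_or_nonempty
  · rw [hsub.antisymm (sdiff_eq_empty_iff_subset.1 hemp), hS]
  · exact mul_le_mul_of_nonpos_right (neg_le_neg (hle _))
      (hind _ (sdiff_ssubset hsub ⟨a, self_mem_permOrbit τ a⟩) hne)

/-- The volume of the intersection over `i ∈ O` of the boxes `∏ j, [0, r i j]`. -/
noncomputable def boxMass {κ : Type*} [Fintype κ] (r : ι → κ → unitInterval) (O : Finset ι) : ℝ :=
  ∏ j, ((O.inf r j : unitInterval) : ℝ)

lemma orbitSum_prod_ite_nonpos {κ : Type*} (J : Finset κ) {S : Finset ι} (hS : S.Nonempty)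
    (b : κ → ι) (hb : ∀ j, b j ∈ S) (c : κ → unitInterval) :
    orbitSum (fun O => -∏ j ∈ J, if b j ∈ O then (c j : ℝ) else 1) S ≤ 0 := by
  classical
  induction J using Finset.induction_on with
  | empty => simpa using orbitSum_neg_one_nonpos hS
  | insert j J hj ih =>
    rw [orbitSum_scale (w := fun O => -∏ j ∈ J, if b j ∈ O then (c j : ℝ) else 1) (hb j) (c j)]
    · exact mul_nonpos_of_nonneg_of_nonpos (c j).2.1 ih
    · intro O hO
      rw [prod_insert hj, if_pos hO, mul_neg]
    · intro O hO
      rw [prod_insert hj, if_neg hO, one_mul]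

theorem orbitSum_boxMass_nonpos {κ : Type*} [Fintype κ] (S : Finset ι) :
    S.Nonempty → ∀ r : ι → κ → unitInterval, orbitSum (fun O => -boxMass r O) S ≤ 0 := by
  classical
  induction S using Finset.strongInduction with
  | H S ih =>
    intro hS r
    choose b hb hmin using fun j => exists_min_image S (fun i => r i j) hS
    let raise : Finset ι → ι → κ → unitInterval :=
      fun A i j => if i ∈ A ∧ i ≠ b j then 1 else r i j
    have hraise_inf : ∀ A j, S.inf (raise A) j = r (b j) j := fun A j => by
      rw [Finset.inf_apply]
      refine le_antisymm ((inf_le (hb j)).trans (by simp [raise])) (Finset.le_inf fun i hi => ?_)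
      simp only [raise]
      split_ifs
      · exact unitInterval.le_one'
      · exact hmin j i hi
    have hstep : ∀ A ⊆ S, orbitSum (fun O => -boxMass r O) S ≤
        orbitSum (fun O => -boxMass (raise A) O) S := by
      intro A
      induction A using Finset.induction_on with
      | empty => simp [raise]
      | insert a A haA hA =>
        intro hsub
        refine (hA ((subset_insert a A).trans hsub)).trans
          (orbitSum_neg_le_orbitSum_neg (hsub (mem_insert_self a A)) ?_ ?_ ?_
            fun T hT hne => ih T hT hne _)
        · intro O
          refine prod_le_prod (fun j _ => (O.inf (raise A) j).2.1) fun j _ => ?_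
          have : O.inf (raise A) ≤ O.inf (raise (insert a A)) := by
            refine Finset.inf_mono_fun fun i _ j => ?_
            simp only [raise, mem_insert]
            split_ifs <;> first | exact unitInterval.le_one' | exact le_rfl | tauto
          exact this j
        · simp only [boxMass, hraise_inf]
        · intro O hO
          have : O.inf (raise A) = O.inf (raise (insert a A)) := by
            refine Finset.inf_congr rfl fun i hi => ?_
            have : i ≠ a := fun h => hO (h ▸ hi)
            simp [raise, this]
          rw [boxMass, boxMass, this]
    refine (hstep S subset_rfl).trans ?_
    refine (orbitSum_congr fun O hO _ => ?_).trans_le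
      (orbitSum_prod_ite_nonpos univ hS b hb fun j => r (b j) j)
    rw [boxMass]
    congr 1
    refine prod_congr rfl fun j _ => ?_
    rw [Finset.inf_apply]
    split_ifs with h
    · congr 1
      refine le_antisymm ((inf_le h).trans (by simp [raise])) (Finset.le_inf fun i hi => ?_)
      simp only [raise]
      split_ifs
      · exact unitInterval.le_one'
      · exact hmin j i (hO hi)
    · have : O.inf (fun i => raise S i j) = 1 := by
        refine le_antisymm unitInterval.le_one' (Finset.le_inf fun i hi => ?_)
        have : i ≠ b j := fun h' => h (h' ▸ hi)
        simp [raise, this, hO hi]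
      simp [this]

end Combinatorics

section LayerCake

open Equiv Finset

variable {Ω : Type*} [MeasurableSpace Ω] {μ : Measure Ω}

lemma layer_integrable_and_integral_eq [IsFiniteMeasure μ] {g h : Ω → ℝ} {C D : ℝ}
    (hg : Measurable g) (hh : Measurable h) (hg0 : ∀ x, 0 ≤ g x) (hgC : ∀ x, g x ≤ C)
    (hhD : ∀ x, |h x| ≤ D) :
    Integrable (fun s => ∫ x, {x | s < g x}.indicator 1 x * h x ∂μ)
        (volume.restrict (Set.Ioc 0 C)) ∧
      ∫ x, g x * h x ∂μ = ∫ s in Set.Ioc 0 C, ∫ x, {x | s < g x}.indicator 1 x * h x ∂μ := by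
  have hint : Integrable
      (Function.uncurry fun (x : Ω) (s : ℝ) => {x | s < g x}.indicator (1 : Ω → ℝ) x * h x)
      (μ.prod (volume.restrict (Set.Ioc 0 C))) := by
    refine Integrable.of_bound (C := D) ?_ (Filter.Eventually.of_forall ?_)
    · refine Measurable.aestronglyMeasurable ?_
      have hset : MeasurableSet {p : Ω × ℝ | p.2 < g p.1} :=
        measurableSet_lt measurable_snd (hg.comp measurable_fst)
      exact ((measurable_const (a := (1 : ℝ))).indicator hset).mul (hh.comp measurable_fst)
    · rintro ⟨x, s⟩
      have hD : 0 ≤ D := (abs_nonneg _).trans (hhD x)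
      by_cases hs : s < g x
      · simpa [Function.uncurry, Set.indicator, hs] using hhD x
      · simpa [Function.uncurry, Set.indicator, hs] using hD
  refine ⟨hint.integral_prod_right, ?_⟩
  rw [← integral_integral_swap hint]
  refine integral_congr_ae (Filter.Eventually.of_forall fun x => ?_)
  simp only
  rw [integral_mul_const]
  congr 1
  have hind : (fun s => {x | s < g x}.indicator (1 : Ω → ℝ) x) =
      (Set.Iio (g x)).indicator (1 : ℝ → ℝ) := by
    ext s
    simp [Set.indicator]
  have hset : Set.Iio (g x) ∩ Set.Ioc 0 C = Set.Ioo 0 (g x) := by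
    ext s
    simp only [Set.mem_inter_iff, Set.mem_Iio, Set.mem_Ioc, Set.mem_Ioo]
    exact ⟨fun h => ⟨h.2.1, h.1⟩, fun h => ⟨h.2, h.1, h.2.le.trans (hgC x)⟩⟩
  rw [hind, integral_indicator_one measurableSet_Iio, measureReal_restrict_apply measurableSet_Iio,
    hset, Real.volume_real_Ioo_of_le (hg0 x), sub_zero]

variable {ι : Type*} [Fintype ι] [DecidableEq ι]

lemma En_eq_neg_orbitSum [Nonempty ι] (f : ι → Ω → ℝ) :
    En μ f = -orbitSum (fun O => -∫ ω, (∏ i ∈ O, f i ω) ∂μ) univ := by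
  have hperms : permsOn (univ : Finset ι) = univ := by
    ext σ
    simp [mem_permsOn]
  rw [En, orbitSum, hperms, ← sum_neg_distrib]
  refine sum_congr rfl fun σ _ => ?_
  have himage : univ.image (permOrbit σ) = permOrbits σ := rfl
  have hcard : 0 < #(permOrbits σ) := card_pos.2 (univ_nonempty.image _)
  obtain ⟨c, hc⟩ := Nat.exists_eq_add_of_lt hcard
  rw [himage, prod_neg, permE, hc]
  simp [pow_succ]

/-- Layer-cake formula for `En` in the variable `a`. -/
lemma En_eq_integral_En_update [IsFiniteMeasure μ] (f : ι → Ω → ℝ) (hf : ∀ i, Measurable (f i))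
    (hf0 : ∀ i x, 0 ≤ f i x) {C : ι → ℝ} (hfC : ∀ i x, f i x ≤ C i) (a : ι) :
    En μ f = ∫ s in Set.Ioc 0 (C a),
      En μ (Function.update f a ({x | s < f a x}.indicator 1)) := by
  have : Nonempty ι := ⟨a⟩
  have hlayer := fun O : Finset ι => layer_integrable_and_integral_eq (μ := μ) (hf a)
    (h := fun x => ∏ i ∈ O.erase a, f i x) (D := ∏ i ∈ O.erase a, C i)
    (Finset.measurable_fun_prod _ fun i _ => hf i) (hf0 a) (hfC a) (fun x => by
      rw [abs_of_nonneg (prod_nonneg fun i _ => hf0 i x)]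
      exact prod_le_prod (fun i _ => hf0 i x) fun i _ => hfC i x)
  have hin : ∀ (g : Ω → ℝ) (O : Finset ι), a ∈ O → ∫ x, ∏ i ∈ O, Function.update f a g i x ∂μ =
      ∫ x, g x * ∏ i ∈ O.erase a, f i x ∂μ := fun g O hO => by
    congr 1 with x
    rw [← mul_prod_erase O _ hO, Function.update_self]
    congr 1
    exact prod_congr rfl fun i hi => by rw [Function.update_of_ne (ne_of_mem_erase hi)]
  have hdecomp : ∀ g : Ω → ℝ, En μ (Function.update f a g) = ∑ τ ∈ cyclesOn univ a,
      (∫ x, g x * ∏ i ∈ (permOrbit τ a).erase a, f i x ∂μ) *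
        orbitSum (fun O => -∫ ω, (∏ i ∈ O, f i ω) ∂μ) (univ \ permOrbit τ a) := fun g => by
    rw [En_eq_neg_orbitSum, orbitSum_eq_sum_cyclesOn _ (mem_univ a), ← sum_neg_distrib]
    refine sum_congr rfl fun τ _ => ?_
    rw [hin g _ (self_mem_permOrbit τ a), neg_mul, neg_neg]
    congr 1
    refine orbitSum_congr fun O hO _ => ?_
    have haO : a ∉ O := fun h => by simpa [self_mem_permOrbit] using hO h
    congr 2 with x
    refine prod_congr rfl fun i hi => ?_
    rw [Function.update_of_ne fun h : i = a => haO (h ▸ hi)]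
  have hself := hdecomp (f a)
  rw [Function.update_eq_self] at hself
  simp only [hdecomp]
  rw [hself, integral_finsetSum _ fun τ _ => (hlayer _).1.mul_const _]
  refine sum_congr rfl fun τ _ => ?_
  rw [integral_mul_const, (hlayer _).2]

end LayerCake

section Boxes

open Equiv Finset

variable {κ : Type*}

/-- The box `∏ j, [0, r j]`. -/
def cornerBox (r : κ → unitInterval) : Set (κ → ℝ) := Set.Icc 0 fun j => (r j : ℝ)

lemma measurableSet_cornerBox [Countable κ] (r : κ → unitInterval) : MeasurableSet (cornerBox r) :=
  measurableSet_Icc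

lemma mem_cornerBox {r : κ → unitInterval} {x : κ → ℝ} :
    x ∈ cornerBox r ↔ ∀ j, 0 ≤ x j ∧ x j ≤ r j := by
  simp [cornerBox, Pi.le_def, forall_and]

/-- `f` vanishes or is the indicator of a box. -/
def IsBoxIndicator (f : (κ → ℝ) → ℝ) : Prop :=
  f = 0 ∨ ∃ r : κ → unitInterval, f = (cornerBox r).indicator 1

lemma IsBoxIndicator.measurable [Countable κ] {f : (κ → ℝ) → ℝ} (hf : IsBoxIndicator f) :
    Measurable f := by
  obtain rfl | ⟨r, rfl⟩ := hf
  · exact measurable_const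
  · exact measurable_one.indicator (measurableSet_cornerBox r)

lemma IsBoxIndicator.nonneg {f : (κ → ℝ) → ℝ} (hf : IsBoxIndicator f) (x : κ → ℝ) : 0 ≤ f x := by
  obtain rfl | ⟨r, rfl⟩ := hf
  · exact le_rfl
  · exact Set.indicator_nonneg (fun _ _ => zero_le_one) x

lemma IsBoxIndicator.le_one {f : (κ → ℝ) → ℝ} (hf : IsBoxIndicator f) (x : κ → ℝ) : f x ≤ 1 := by
  obtain rfl | ⟨r, rfl⟩ := hf
  · exact zero_le_one
  · exact Set.indicator_le_self' (fun _ _ => zero_le_one) x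

variable [Fintype κ]

lemma integral_prod_indicator_cornerBox {ι : Type*} (r : ι → κ → unitInterval) {O : Finset ι} (hO : O.Nonempty) :
    ∫ x in Set.Icc (0 : κ → ℝ) 1, (∏ i ∈ O, (cornerBox (r i)).indicator 1 x) = boxMass r O := by
  have hprod : (fun x : κ → ℝ => ∏ i ∈ O, (cornerBox (r i)).indicator (1 : (κ → ℝ) → ℝ) x) =
      (cornerBox (O.inf r)).indicator 1 := by
    ext x
    have hmem : x ∈ cornerBox (O.inf r) ↔ ∀ i ∈ O, x ∈ cornerBox (r i) := by
      simp only [mem_cornerBox]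
      refine ⟨fun h i hi j => ⟨(h j).1, (h j).2.trans ?_⟩, fun h j => ?_⟩
      · exact Subtype.coe_le_coe.2 (Finset.inf_le (f := r) hi j)
      · obtain ⟨i, hi, hij⟩ := exists_min_image O (fun i => r i j) hO
        refine ⟨(h i hi j).1, (h i hi j).2.trans (Subtype.coe_le_coe.2 ?_)⟩
        rw [Finset.inf_apply]
        exact Finset.le_inf hij
    by_cases hx : x ∈ cornerBox (O.inf r)
    · rw [Set.indicator_of_mem hx]
      exact prod_eq_one fun i hi => Set.indicator_of_mem (hmem.1 hx i hi) _
    · rw [Set.indicator_of_notMem hx]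
      rw [hmem] at hx
      push Not at hx
      obtain ⟨i, hi, hix⟩ := hx
      exact prod_eq_zero hi (Set.indicator_of_notMem hix _)
  have hsub : cornerBox (O.inf r) ⊆ Set.Icc 0 1 :=
    Set.Icc_subset_Icc le_rfl fun j => (O.inf r j).2.2
  rw [hprod, integral_indicator_one (measurableSet_cornerBox _),
    measureReal_restrict_apply (measurableSet_cornerBox _), Set.inter_eq_left.2 hsub, measureReal_def,
    cornerBox, Real.volume_Icc_pi_toReal (a := 0) fun j => (O.inf r j).2.1]
  simp [boxMass]

variable {ι : Type*} [Fintype ι] [DecidableEq ι]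

lemma En_nonneg_of_isBoxIndicator [Nonempty ι] {f : ι → (κ → ℝ) → ℝ}
    (hf : ∀ i, IsBoxIndicator (f i)) :
    0 ≤ En (volume.restrict (Set.Icc (0 : κ → ℝ) 1)) f := by
  rw [En_eq_neg_orbitSum, neg_nonneg]
  by_cases h0 : ∃ a, f a = 0
  · obtain ⟨a, ha⟩ := h0
    rw [orbitSum_eq_sum_cyclesOn _ (mem_univ a)]
    refine (sum_eq_zero fun τ _ => ?_).le
    have : ∀ x, ∏ i ∈ permOrbit τ a, f i x = 0 := fun x =>
      prod_eq_zero (self_mem_permOrbit τ a) (by simp [ha])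
    simp [this]
  · push Not at h0
    choose r hr using fun i => (hf i).resolve_left (h0 i)
    refine (orbitSum_congr fun O _ hO => ?_).trans_le
      (orbitSum_boxMass_nonpos univ univ_nonempty r)
    simp only [hr]
    rw [integral_prod_indicator_cornerBox r hO]

lemma En_nonneg_of_layers_isBoxIndicator [Nonempty ι] {C : ι → ℝ} (A : Finset ι) :
    ∀ f : ι → (κ → ℝ) → ℝ, (∀ i, Measurable (f i)) → (∀ i x, 0 ≤ f i x) →
    (∀ i x, f i x ≤ C i) → (∀ i, 1 ≤ C i) →
    (∀ i ∈ A, ∀ s > 0, IsBoxIndicator ({x | s < f i x}.indicator 1)) →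
    (∀ i ∉ A, IsBoxIndicator (f i)) →
    0 ≤ En (volume.restrict (Set.Icc (0 : κ → ℝ) 1)) f := by
  induction A using Finset.induction_on with
  | empty => exact fun f _ _ _ _ _ hbox => En_nonneg_of_isBoxIndicator fun i => hbox i (by simp)
  | insert a A ha ih =>
    intro f hf hf0 hfC hC hlayer hbox
    have : IsFiniteMeasure (volume.restrict (Set.Icc (0 : κ → ℝ) 1)) :=
      isFiniteMeasure_restrict.2 isCompact_Icc.measure_ne_top
    rw [En_eq_integral_En_update f hf hf0 hfC a]
    refine setIntegral_nonneg measurableSet_Ioc fun s hs => ?_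
    have hs' := hlayer a (mem_insert_self a A) s hs.1
    have key : ∀ p : ι → ((κ → ℝ) → ℝ) → Prop,
        p a ({x | s < f a x}.indicator 1) → (∀ i, i ≠ a → p i (f i)) →
        ∀ i, p i (Function.update f a ({x | s < f a x}.indicator 1) i) := fun p hp h i => by
      obtain rfl | hi := eq_or_ne i a
      · rwa [Function.update_self]
      · rw [Function.update_of_ne hi]
        exact h i hi
    refine ih _ ?_ ?_ ?_ hC ?_ ?_
    · exact key (fun _ g => Measurable g) hs'.measurable fun i _ => hf i
    · exact key (fun _ g => ∀ x, 0 ≤ g x) hs'.nonneg fun i _ => hf0 i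
    · exact key (fun i g => ∀ x, g x ≤ C i) (fun x => (hs'.le_one x).trans (hC a))
        fun i _ => hfC i
    · exact key (fun i g => i ∈ A → ∀ s > 0, IsBoxIndicator ({x | s < g x}.indicator 1))
        (fun h => absurd h ha) fun i _ hi => hlayer i (mem_insert_of_mem hi)
    · exact key (fun i g => i ∉ A → IsBoxIndicator g) (fun _ => hs')
        fun i hia hi => hbox i (by simp [hia, hi])

end Boxes

/-- Let `k, n ≥ 1` and let `f¹,…,fⁿ` be nonnegative, bounded, measurable,
monotone decreasing functions on `[0,1]^k` such that for every `s > 0` and every `i`, the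
upper level set `{x ∈ [0,1]^k : fⁱ(x) > s}` is a `k`-rectangle `[0,r₁] × ⋯ × [0,r_k]`
(possibly empty).  Then, with respect to Lebesgue (probability) measure on `[0,1]^k`,
`E_n(f¹,…,fⁿ) ≥ 0`. -/
theorem stmt_10 (k n : ℕ) (hk : 1 ≤ k) (hn : 1 ≤ n)
    (f : Fin n → (Fin k → ℝ) → ℝ)
    (hmeas : ∀ i, Measurable (f i))
    (hpos : ∀ i, ∀ x ∈ Set.Icc (0 : Fin k → ℝ) 1, 0 ≤ f i x)
    (hbdd : ∀ i, ∃ C, ∀ x ∈ Set.Icc (0 : Fin k → ℝ) 1, |f i x| ≤ C)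
    (hmono : ∀ i, ∀ x ∈ Set.Icc (0 : Fin k → ℝ) 1, ∀ y ∈ Set.Icc (0 : Fin k → ℝ) 1,
      x ≤ y → f i y ≤ f i x)
    (hlevel : ∀ i, ∀ s > (0 : ℝ),
      {x ∈ Set.Icc (0 : Fin k → ℝ) 1 | s < f i x} = ∅ ∨
      ∃ r : Fin k → ℝ, (∀ j, 0 ≤ r j) ∧ (∀ j, r j ≤ 1) ∧
        {x ∈ Set.Icc (0 : Fin k → ℝ) 1 | s < f i x} = Set.Icc 0 r) :
    0 ≤ En (volume.restrict (Set.Icc (0 : Fin k → ℝ) 1)) f := by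
  have : Nonempty (Fin n) := ⟨⟨0, hn⟩⟩
  choose C hC using hbdd
  let F : Fin n → (Fin k → ℝ) → ℝ := fun i => (Set.Icc 0 1).indicator (f i)
  have hF : En (volume.restrict (Set.Icc (0 : Fin k → ℝ) 1)) f =
      En (volume.restrict (Set.Icc (0 : Fin k → ℝ) 1)) F := by
    refine Finset.sum_congr rfl fun σ _ => ?_
    congr 1
    refine Finset.prod_congr rfl fun O _ => ?_
    refine setIntegral_congr_fun measurableSet_Icc fun x hx => ?_
    exact Finset.prod_congr rfl fun i _ => (Set.indicator_of_mem hx _).symm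
  rw [hF]
  refine En_nonneg_of_layers_isBoxIndicator (C := fun i => max (C i) 1) Finset.univ F
    (fun i => (hmeas i).indicator measurableSet_Icc)
    (fun i x => Set.indicator_nonneg (hpos i) x) (fun i x => ?_) (fun i => le_max_right _ _)
    (fun i _ s hs => ?_) (fun i hi => absurd (Finset.mem_univ i) hi)
  · by_cases hx : x ∈ Set.Icc (0 : Fin k → ℝ) 1
    · simp only [F, Set.indicator_of_mem hx]
      exact (le_abs_self _).trans ((hC i x hx).trans (le_max_left _ _))
    · simp only [F, Set.indicator_of_notMem hx]
      exact zero_le_one.trans (le_max_right _ _)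
  · have hset : {x | s < F i x} = {x ∈ Set.Icc (0 : Fin k → ℝ) 1 | s < f i x} := by
      ext x
      by_cases hx : x ∈ Set.Icc (0 : Fin k → ℝ) 1
      · simp only [F, Set.mem_ofPred_eq, Set.indicator_of_mem hx, hx, true_and]
      · simp only [F, Set.mem_ofPred_eq, Set.indicator_of_notMem hx, hx, false_and, hs.not_gt]
    rw [hset]
    obtain h | ⟨r, hr0, hr1, h⟩ := hlevel i s hs
    · exact Or.inl (by rw [h, Set.indicator_empty]; rfl)
    · exact Or.inr ⟨fun j => ⟨r j, hr0 j, hr1 j⟩, by rw [h]; rfl⟩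
end
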